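/- arXiv:1805.03860 — 4 statements merged into one kernel-verified Lean document; each statement's English description precedes it below -/
import Mathlib

section
/- The common zero set in ℙ²(ℂ) of the five cubic forms x₁³ + 2x₂²x₀ − x₁x₀² − 2x₂x₀², x₁²x₂, x₁x₂² − 2x₂²x₀ + 2x₂x₀², x₁x₂x₀ − 2x₂²x₀ + 2x₂x₀², and x₂³ − 2x₂²x₀ + x₂x₀² is exactly the set of four points {(1 : −1 : 0), (1 : 0 : 0), (1 : 1 : 0), (1 : 0 : 1)} (in coordinates (x₀ : x₁ : x₂)). -/
/-- The common zero set in `ℙ²(ℂ)` of the five cubic forms defining `𝓗` is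
exactly the four points `(1 : −1 : 0)`, `(1 : 0 : 0)`, `(1 : 1 : 0)`,
`(1 : 0 : 1)`: a nonzero `(x₀, x₁, x₂) ∈ ℂ³` is a common zero of the five
cubics iff it is a nonzero scalar multiple of one of these four points. -/
theorem stmt_8 (x₀ x₁ x₂ : ℂ) (hx : ¬(x₀ = 0 ∧ x₁ = 0 ∧ x₂ = 0)) :
    (x₁ ^ 3 + 2 * x₂ ^ 2 * x₀ - x₁ * x₀ ^ 2 - 2 * x₂ * x₀ ^ 2 = 0 ∧
     x₁ ^ 2 * x₂ = 0 ∧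
     x₁ * x₂ ^ 2 - 2 * x₂ ^ 2 * x₀ + 2 * x₂ * x₀ ^ 2 = 0 ∧
     x₁ * x₂ * x₀ - 2 * x₂ ^ 2 * x₀ + 2 * x₂ * x₀ ^ 2 = 0 ∧
     x₂ ^ 3 - 2 * x₂ ^ 2 * x₀ + x₂ * x₀ ^ 2 = 0) ↔
    (∃ lam : ℂ, lam ≠ 0 ∧
      ((x₀, x₁, x₂) = (lam, -lam, 0) ∨
       (x₀, x₁, x₂) = (lam, 0, 0) ∨
       (x₀, x₁, x₂) = (lam, lam, 0) ∨
       (x₀, x₁, x₂) = (lam, 0, lam))) := by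
  simp only [Prod.mk.injEq]
  constructor
  · rintro ⟨h₁, h₂, -, -, h₅⟩
    rcases eq_or_ne x₂ 0 with rfl | hx₂
    · have h : x₁ * ((x₁ - x₀) * (x₁ + x₀)) = 0 := by linear_combination h₁
      have hx₀ : x₀ ≠ 0 := by
        rintro rfl
        exact hx ⟨rfl, by simpa using h, rfl⟩
      refine ⟨x₀, hx₀, ?_⟩
      rcases mul_eq_zero.mp h with h | h
      · exact Or.inr (Or.inl ⟨rfl, h, rfl⟩)
      rcases mul_eq_zero.mp h with h | h
      · exact Or.inr (Or.inr (Or.inl ⟨rfl, sub_eq_zero.mp h, rfl⟩))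
      · exact Or.inl ⟨rfl, eq_neg_of_add_eq_zero_left h, rfl⟩
    · have hx₁ : x₁ = 0 := by simpa [hx₂] using h₂
      have h : x₂ * (x₀ - x₂) ^ 2 = 0 := by linear_combination h₅
      have hx₀ : x₀ = x₂ := by simpa [hx₂, sub_eq_zero] using h
      exact ⟨x₂, hx₂, Or.inr (Or.inr (Or.inr ⟨hx₀, hx₁, rfl⟩))⟩
  · rintro ⟨lam, -, ⟨rfl, rfl, rfl⟩ | ⟨rfl, rfl, rfl⟩ | ⟨rfl, rfl, rfl⟩ | ⟨rfl, rfl, rfl⟩⟩ <;>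
      refine ⟨?_, ?_, ?_, ?_, ?_⟩ <;> ring
end

section
/- For every (α₀ : α₁) ∈ ℙ¹(ℂ), let C_α := { (x₀ : x₁ : x₂) ∈ ℙ²(ℂ) : α₀x₁ + α₁(x₂ − x₀) = 0 }. Then there exist two linearly independent linear forms ℓ₁, ℓ₂ on ℂ⁵ (depending on α) such that ℓ₁ and ℓ₂ vanish at 𝓗(x) for every x ∈ C_α at which 𝓗 is defined. That is, the image 𝓗(C_α) is contained in a projective plane of ℙ⁴ for every α, so the curves 𝓗(C_α) form a 1-dimensional family of conics on X. -/
/-- The birational map `𝓗 : ℙ² ⇢ X ⊂ ℙ⁴`, given on homogeneous coordinates. -/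
def Hmap (x₀ x₁ x₂ : ℂ) : Fin 5 → ℂ :=
  ![x₁ ^ 3 + 2 * x₂ ^ 2 * x₀ - x₁ * x₀ ^ 2 - 2 * x₂ * x₀ ^ 2,
    x₁ ^ 2 * x₂,
    x₁ * x₂ ^ 2 - 2 * x₂ ^ 2 * x₀ + 2 * x₂ * x₀ ^ 2,
    x₁ * x₂ * x₀ - 2 * x₂ ^ 2 * x₀ + 2 * x₂ * x₀ ^ 2,
    x₂ ^ 3 - 2 * x₂ ^ 2 * x₀ + x₂ * x₀ ^ 2]

/-- For every `(α₀ : α₁) ∈ ℙ¹(ℂ)`, letting `C_α` be the line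
`α₀x₁ + α₁(x₂ − x₀) = 0`, there exist two linearly independent linear forms on
`ℂ⁵` vanishing at `𝓗(x)` for every `x ∈ C_α` at which `𝓗` is defined: hence
`𝓗(C_α)` lies in a projective plane of `ℙ⁴`, and the curves `𝓗(C_α)` form a
1-dimensional family of conics on `X`. -/
theorem stmt_10 (α₀ α₁ : ℂ) (hα : ¬(α₀ = 0 ∧ α₁ = 0)) :
    ∃ ℓ₁ ℓ₂ : Module.Dual ℂ (Fin 5 → ℂ),
      LinearIndependent ℂ ![ℓ₁, ℓ₂] ∧
      ∀ x₀ x₁ x₂ : ℂ, ¬(x₀ = 0 ∧ x₁ = 0 ∧ x₂ = 0) →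
        α₀ * x₁ + α₁ * (x₂ - x₀) = 0 →
        Hmap x₀ x₁ x₂ ≠ 0 →
        ℓ₁ (Hmap x₀ x₁ x₂) = 0 ∧ ℓ₂ (Hmap x₀ x₁ x₂) = 0 := by
  let y (i : Fin 5) : Module.Dual ℂ (Fin 5 → ℂ) := LinearMap.proj i
  refine ⟨α₀ • y 1 + α₁ • (y 2 - y 3), α₀ • (y 2 - y 3) + α₁ • y 4, ?_, ?_⟩
  · rw [LinearIndependent.pair_iff]
    intro s t h
    have h₁ : s * α₀ = 0 := by
      simpa [y] using LinearMap.congr_fun h (Pi.single 1 1)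
    have h₂ : s * α₁ + t * α₀ = 0 := by
      simpa [y] using LinearMap.congr_fun h (Pi.single 2 1)
    have h₄ : t * α₁ = 0 := by
      simpa [y] using LinearMap.congr_fun h (Pi.single 4 1)
    grind
  · intro x₀ x₁ x₂ _ hC _
    constructor
    · simp [y, Hmap]
      linear_combination x₁ * x₂ * hC
    · simp [y, Hmap]
      linear_combination x₂ * (x₂ - x₀) * hC
end

section
/- Let η ∈ ℂ satisfy η² − η + 1 = 0. The set of points (x₀ : x₁ : x₂) ∈ ℙ²(ℂ) satisfying both x₀² + x₁² + x₂² = 0 and x₀²x₁² + x₁²x₂² + x₀²x₂² = 0 is exactly the set of eight points { (1 : η−1 : −η), (1 : −η : η−1), (1 : −η+1 : η), (1 : η : −η+1), (1 : η−1 : η), (1 : −η : −η+1), (1 : −η+1 : −η), (1 : η : η−1) }. Equivalently, these eight points are exactly the common zeros in ℙ²(ℂ) of the five quartic forms x₁⁴ + 3x₁²x₂² + x₂⁴ + 3x₁²x₀² + 3x₂²x₀² + x₀⁴, x₀x₁(x₁² + x₂² + x₀²), x₂x₁(x₁² + x₂² + x₀²), x₀x₂(x₁² + x₂² + x₀²),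 and x₁⁴ + x₁²x₂² + x₂⁴ + x₁²x₀² + x₂²x₀² + x₀⁴. -/
/-- Over a field with a root `η` of `X² - X + 1`, the nonzero common zeros of the first two
elementary symmetric polynomials in the squares of the coordinates. -/
theorem esymm_sq_eq_zero_iff {K : Type*} [Field K] {η : K} (hη : η ^ 2 - η + 1 = 0)
    {x₀ x₁ x₂ : K} (hx : ¬(x₀ = 0 ∧ x₁ = 0 ∧ x₂ = 0)) :
    (x₀ ^ 2 + x₁ ^ 2 + x₂ ^ 2 = 0 ∧
        x₀ ^ 2 * x₁ ^ 2 + x₁ ^ 2 * x₂ ^ 2 + x₀ ^ 2 * x₂ ^ 2 = 0) ↔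
      (∃ lam : K, lam ≠ 0 ∧
        ((x₀, x₁, x₂) = (lam, lam * (η - 1), lam * (-η)) ∨
         (x₀, x₁, x₂) = (lam, lam * (-η), lam * (η - 1)) ∨
         (x₀, x₁, x₂) = (lam, lam * (-η + 1), lam * η) ∨
         (x₀, x₁, x₂) = (lam, lam * η, lam * (-η + 1)) ∨
         (x₀, x₁, x₂) = (lam, lam * (η - 1), lam * η) ∨
         (x₀, x₁, x₂) = (lam, lam * (-η), lam * (-η + 1)) ∨
         (x₀, x₁, x₂) = (lam, lam * (-η + 1), lam * (-η)) ∨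
         (x₀, x₁, x₂) = (lam, lam * η, lam * (η - 1)))) := by
  constructor
  · rintro ⟨h₁, h₂⟩
    have hfac : (x₁ ^ 2 + η * x₀ ^ 2) * (x₁ ^ 2 - (η - 1) * x₀ ^ 2) = 0 := by
      linear_combination (x₀ ^ 2 + x₁ ^ 2) * h₁ - h₂ - x₀ ^ 4 * hη
    have hx₀ : x₀ ≠ 0 := by
      rintro rfl
      have h : x₁ = 0 := by simpa using hfac
      subst h
      exact hx ⟨rfl, rfl, by simpa using h₁⟩
    refine ⟨x₀, hx₀, ?_⟩
    simp only [Prod.mk.injEq, true_and]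
    rcases mul_eq_zero.mp hfac with h | h
    · have e₁ : x₁ ^ 2 = (x₀ * (η - 1)) ^ 2 := by
        linear_combination h - x₀ ^ 2 * hη
      have e₂ : x₂ ^ 2 = (x₀ * η) ^ 2 := by
        linear_combination h₁ - h - x₀ ^ 2 * hη
      rcases sq_eq_sq_iff_eq_or_eq_neg.mp e₁ with rfl | rfl <;>
        rcases sq_eq_sq_iff_eq_or_eq_neg.mp e₂ with rfl | rfl <;> grind
    · have e₁ : x₁ ^ 2 = (x₀ * η) ^ 2 := by
        linear_combination h - x₀ ^ 2 * hη
      have e₂ : x₂ ^ 2 = (x₀ * (η - 1)) ^ 2 := by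
        linear_combination h₁ - h - x₀ ^ 2 * hη
      rcases sq_eq_sq_iff_eq_or_eq_neg.mp e₁ with rfl | rfl <;>
        rcases sq_eq_sq_iff_eq_or_eq_neg.mp e₂ with rfl | rfl <;> grind
  · rintro ⟨l, -, h⟩
    simp only [Prod.mk.injEq] at h
    rcases h with h | h | h | h | h | h | h | h <;> obtain ⟨rfl, rfl, rfl⟩ := h <;>
      exact ⟨by linear_combination 2 * x₀ ^ 2 * hη,
        by linear_combination x₀ ^ 4 * (η ^ 2 - η + 1) * hη⟩


/-- Let `η ∈ ℂ` with `η² − η + 1 = 0`. A nonzero `(x₀, x₁, x₂) ∈ ℂ³` satisfies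
both `x₀² + x₁² + x₂² = 0` and `x₀²x₁² + x₁²x₂² + x₀²x₂² = 0` iff it is a
nonzero scalar multiple of one of the eight listed points; equivalently, these
eight points are exactly the common zeros in `ℙ²(ℂ)` of the five quartic forms
defining the inverse stereographic projection of the Roman surface. -/
theorem stmt_11 (η : ℂ) (hη : η ^ 2 - η + 1 = 0)
    (x₀ x₁ x₂ : ℂ) (hx : ¬(x₀ = 0 ∧ x₁ = 0 ∧ x₂ = 0)) :
    ((x₀ ^ 2 + x₁ ^ 2 + x₂ ^ 2 = 0 ∧
        x₀ ^ 2 * x₁ ^ 2 + x₁ ^ 2 * x₂ ^ 2 + x₀ ^ 2 * x₂ ^ 2 = 0) ↔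
      (∃ lam : ℂ, lam ≠ 0 ∧
        ((x₀, x₁, x₂) = (lam, lam * (η - 1), lam * (-η)) ∨
         (x₀, x₁, x₂) = (lam, lam * (-η), lam * (η - 1)) ∨
         (x₀, x₁, x₂) = (lam, lam * (-η + 1), lam * η) ∨
         (x₀, x₁, x₂) = (lam, lam * η, lam * (-η + 1)) ∨
         (x₀, x₁, x₂) = (lam, lam * (η - 1), lam * η) ∨
         (x₀, x₁, x₂) = (lam, lam * (-η), lam * (-η + 1)) ∨
         (x₀, x₁, x₂) = (lam, lam * (-η + 1), lam * (-η)) ∨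
         (x₀, x₁, x₂) = (lam, lam * η, lam * (η - 1))))) ∧
    ((x₁ ^ 4 + 3 * x₁ ^ 2 * x₂ ^ 2 + x₂ ^ 4 + 3 * x₁ ^ 2 * x₀ ^ 2 +
          3 * x₂ ^ 2 * x₀ ^ 2 + x₀ ^ 4 = 0 ∧
        x₀ * x₁ * (x₁ ^ 2 + x₂ ^ 2 + x₀ ^ 2) = 0 ∧
        x₂ * x₁ * (x₁ ^ 2 + x₂ ^ 2 + x₀ ^ 2) = 0 ∧
        x₀ * x₂ * (x₁ ^ 2 + x₂ ^ 2 + x₀ ^ 2) = 0 ∧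
        x₁ ^ 4 + x₁ ^ 2 * x₂ ^ 2 + x₂ ^ 4 + x₁ ^ 2 * x₀ ^ 2 +
          x₂ ^ 2 * x₀ ^ 2 + x₀ ^ 4 = 0) ↔
      (∃ lam : ℂ, lam ≠ 0 ∧
        ((x₀, x₁, x₂) = (lam, lam * (η - 1), lam * (-η)) ∨
         (x₀, x₁, x₂) = (lam, lam * (-η), lam * (η - 1)) ∨
         (x₀, x₁, x₂) = (lam, lam * (-η + 1), lam * η) ∨
         (x₀, x₁, x₂) = (lam, lam * η, lam * (-η + 1)) ∨
         (x₀, x₁, x₂) = (lam, lam * (η - 1), lam * η) ∨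
         (x₀, x₁, x₂) = (lam, lam * (-η), lam * (-η + 1)) ∨
         (x₀, x₁, x₂) = (lam, lam * (-η + 1), lam * (-η)) ∨
         (x₀, x₁, x₂) = (lam, lam * η, lam * (η - 1))))) := by
  refine ⟨esymm_sq_eq_zero_iff hη hx, Iff.trans ?_ (esymm_sq_eq_zero_iff hη hx)⟩
  constructor
  · rintro ⟨h₀, -, -, -, h₄⟩
    have h : (x₀ ^ 2 + x₁ ^ 2 + x₂ ^ 2) ^ 2 = 0 := by
      linear_combination (h₀ + h₄) / 2
    exact ⟨pow_eq_zero_iff two_ne_zero |>.mp h, by linear_combination (h₀ - h₄) / 2⟩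
  · rintro ⟨h₁, h₂⟩
    refine ⟨?_, ?_, ?_, ?_, ?_⟩
    · linear_combination (x₀ ^ 2 + x₁ ^ 2 + x₂ ^ 2) * h₁ + h₂
    · linear_combination x₀ * x₁ * h₁
    · linear_combination x₂ * x₁ * h₁
    · linear_combination x₀ * x₂ * h₁
    · linear_combination (x₀ ^ 2 + x₁ ^ 2 + x₂ ^ 2) * h₁ - h₂
end

section
/- For each of the four lines L ⊂ ℙ² defined by x₀ + x₁ + x₂ = 0, x₀ − x₁ − x₂ = 0, x₀ + x₁ − x₂ = 0, and x₀ − x₁ + x₂ = 0, there exist two linearly independent linear forms ℓ₁, ℓ₂ on ℂ⁵ such that ℓ₁ and ℓ₂ vanish at 𝓖(x) for every x ∈ L at which 𝓖 is defined. That is, the image of each of these four lines under 𝓖 is contained in a projective plane of ℙ⁴; since this image also lies on the Möbius sphere 𝕊³, each of these images is a conic on 𝕊³, giving the four circles on the Roman surface. -/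
/-- The parametrization `𝓖 : ℙ² ⇢ Y ⊂ 𝕊³ ⊂ ℙ⁴` of the inverse stereographic
projection of the Roman surface, given on homogeneous coordinates. -/
def Gmap (x₀ x₁ x₂ : ℂ) : Fin 5 → ℂ :=
  ![x₁ ^ 4 + 3 * x₁ ^ 2 * x₂ ^ 2 + x₂ ^ 4 + 3 * x₁ ^ 2 * x₀ ^ 2 +
      3 * x₂ ^ 2 * x₀ ^ 2 + x₀ ^ 4,
    -2 * x₀ * x₁ * (x₁ ^ 2 + x₂ ^ 2 + x₀ ^ 2),
    -2 * x₂ * x₁ * (x₁ ^ 2 + x₂ ^ 2 + x₀ ^ 2),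
    2 * x₀ * x₂ * (x₁ ^ 2 + x₂ ^ 2 + x₀ ^ 2),
    -(x₁ ^ 4 + x₁ ^ 2 * x₂ ^ 2 + x₂ ^ 4 + x₁ ^ 2 * x₀ ^ 2 +
        x₂ ^ 2 * x₀ ^ 2 + x₀ ^ 4)]

/-- The image of `Gmap` lies on the Möbius sphere. -/
theorem Gmap_mem_sphere (x₀ x₁ x₂ : ℂ) :
    -(Gmap x₀ x₁ x₂ 0) ^ 2 + (Gmap x₀ x₁ x₂ 1) ^ 2 + (Gmap x₀ x₁ x₂ 2) ^ 2 +
      (Gmap x₀ x₁ x₂ 3) ^ 2 + (Gmap x₀ x₁ x₂ 4) ^ 2 = 0 := by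
  simp only [Gmap, Matrix.cons_val]
  ring

/-- On a line `x₀ + s·x₁ + t·x₂ = 0` with `s² = t² = 1`, the first and last coordinates of
`Gmap` are proportional. -/
theorem Gmap_zero_four_of_line {s t x₀ x₁ x₂ : ℂ} (hs : s ^ 2 = 1) (ht : t ^ 2 = 1)
    (hx : x₀ + s * x₁ + t * x₂ = 0) :
    3 * Gmap x₀ x₁ x₂ 0 + 5 * Gmap x₀ x₁ x₂ 4 = 0 := by
  obtain rfl : x₀ = -(s * x₁ + t * x₂) := by linear_combination hx
  simp only [Gmap, Matrix.cons_val]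
  grind

/-- On a line `x₀ + s·x₁ + t·x₂ = 0` with `s² = t² = 1`, the first four coordinates of `Gmap`
satisfy a linear relation. -/
theorem Gmap_zero_one_two_three_of_line {s t x₀ x₁ x₂ : ℂ} (hs : s ^ 2 = 1) (ht : t ^ 2 = 1)
    (hx : x₀ + s * x₁ + t * x₂ = 0) :
    4 * Gmap x₀ x₁ x₂ 0 +
      5 * (-s * Gmap x₀ x₁ x₂ 1 - s * t * Gmap x₀ x₁ x₂ 2 + t * Gmap x₀ x₁ x₂ 3) = 0 := by
  obtain rfl : x₀ = -(s * x₁ + t * x₂) := by linear_combination hx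
  simp only [Gmap, Matrix.cons_val]
  grind

/-- For each of the four lines `x₀ + s·x₁ + t·x₂ = 0` with
`(s,t) ∈ {(1,1), (−1,−1), (1,−1), (−1,1)}`, there exist two linearly independent
linear forms on `ℂ⁵` vanishing at `𝓖(x)` for every point `x` of the line at
which `𝓖` is defined; moreover the image lies on the Möbius sphere
`−z₀² + z₁² + z₂² + z₃² + z₄² = 0`. Hence the image of each line is a conic on
`𝕊³`: these are the four circles on the Roman surface. -/
theorem stmt_12 (s t : ℂ)
    (hst : (s, t) = (1, 1) ∨ (s, t) = (-1, -1) ∨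
           (s, t) = (1, -1) ∨ (s, t) = (-1, 1)) :
    ∃ ℓ₁ ℓ₂ : Module.Dual ℂ (Fin 5 → ℂ),
      LinearIndependent ℂ ![ℓ₁, ℓ₂] ∧
      ∀ x₀ x₁ x₂ : ℂ, ¬(x₀ = 0 ∧ x₁ = 0 ∧ x₂ = 0) →
        x₀ + s * x₁ + t * x₂ = 0 →
        Gmap x₀ x₁ x₂ ≠ 0 →
        (ℓ₁ (Gmap x₀ x₁ x₂) = 0 ∧ ℓ₂ (Gmap x₀ x₁ x₂) = 0) ∧
          -(Gmap x₀ x₁ x₂ 0) ^ 2 + (Gmap x₀ x₁ x₂ 1) ^ 2 +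
            (Gmap x₀ x₁ x₂ 2) ^ 2 + (Gmap x₀ x₁ x₂ 3) ^ 2 +
            (Gmap x₀ x₁ x₂ 4) ^ 2 = 0 := by
  have hs : s ^ 2 = 1 := by
    rcases hst with h | h | h | h <;> obtain ⟨rfl, rfl⟩ := Prod.mk.inj h <;> norm_num
  have ht : t ^ 2 = 1 := by
    rcases hst with h | h | h | h <;> obtain ⟨rfl, rfl⟩ := Prod.mk.inj h <;> norm_num
  let z (i : Fin 5) : Module.Dual ℂ (Fin 5 → ℂ) := LinearMap.proj i
  refine ⟨(3 : ℂ) • z 0 + (5 : ℂ) • z 4,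
    (4 : ℂ) • z 0 + (5 : ℂ) • (-s • z 1 - (s * t) • z 2 + t • z 3), ?_, ?_⟩
  · rw [LinearIndependent.pair_iff]
    intro a b h
    have ha := LinearMap.congr_fun h (Pi.single 4 1)
    have hb := LinearMap.congr_fun h (Pi.single 0 1)
    simp [z] at ha hb
    simpa [ha] using hb
  · intro x₀ x₁ x₂ _ hx _
    refine ⟨⟨?_, ?_⟩, Gmap_mem_sphere x₀ x₁ x₂⟩
    · simpa [z] using Gmap_zero_four_of_line hs ht hx
    · simpa [z, mul_add] using Gmap_zero_one_two_three_of_line hs ht hx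
end
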